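/- Let G be an unsatisfiable CNF formula, F ⊆ G a pseudo-factor of G, and C a clause interpolant of (F, G \ F). Then G has a resolution refutation of length at most h(F[¬C]) + h({C} ∪ (G \ F)) − 1. -/

import Mathlib

/-- A literal: a variable (natural number) with a polarity. -/
abbrev Lit : Type := ℕ × Bool

/-- Negation of a literal. -/
def Lit.neg (ℓ : Lit) : Lit := (ℓ.1, !ℓ.2)

/-- A clause: a finite set of literals. -/
abbrev Clause : Type := Finset Lit

/-- A clause is non-tautological: it contains no literal together with its negation. -/
def Clause.NonTaut (C : Clause) : Prop := ∀ ℓ ∈ C, Lit.neg ℓ ∉ C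

/-- A CNF formula: a finite set of clauses. -/
abbrev CNF : Type := Finset Clause

/-- A CNF formula is well-formed if all of its clauses are non-tautological. -/
def CNF.WellFormed (F : CNF) : Prop := ∀ C ∈ F, C.NonTaut

/-- A (total) assignment `τ` satisfies a literal. -/
def SatLit (τ : ℕ → Bool) (ℓ : Lit) : Prop := τ ℓ.1 = ℓ.2

/-- An assignment satisfies a clause if it satisfies some literal of it. -/
def SatClause (τ : ℕ → Bool) (C : Clause) : Prop := ∃ ℓ ∈ C, SatLit τ ℓ

/-- An assignment satisfies a CNF formula if it satisfies all of its clauses. -/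
def SatCNF (τ : ℕ → Bool) (F : CNF) : Prop := ∀ C ∈ F, SatClause τ C

/-- A CNF formula is unsatisfiable if no assignment satisfies it. -/
def Unsat (F : CNF) : Prop := ¬ ∃ τ : ℕ → Bool, SatCNF τ F

/-- `F` entails `G`: every model of `F` is a model of `G`. -/
def Entails (F G : CNF) : Prop := ∀ τ : ℕ → Bool, SatCNF τ F → SatCNF τ G

/-- Logical equivalence of CNF formulas. -/
def Equivalent (F G : CNF) : Prop := Entails F G ∧ Entails G F

/-- Two clauses clash: one contains a literal whose negation is in the other. -/
def Clash (C D : Clause) : Prop := ∃ ℓ ∈ C, Lit.neg ℓ ∈ D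

/-- A formula is hitting if every pair of distinct clauses clashes. -/
def Hitting (F : CNF) : Prop := ∀ C ∈ F, ∀ D ∈ F, C ≠ D → Clash C D

/-- The set of variables occurring in a CNF formula. -/
def cnfVars (F : CNF) : Finset ℕ := F.sup fun C => C.image Prod.fst

/-- `D` is the resolvent of `C₁` and `C₂` (on the unique clashing literal `ℓ`). -/
def Resolvent (C₁ C₂ D : Clause) : Prop :=
  ∃ ℓ : Lit, C₁ ∩ C₂.image Lit.neg = {ℓ} ∧ D = (C₁ ∪ C₂) \ {ℓ, Lit.neg ℓ}

/-- `L` is a resolution refutation of `F`: every clause of the sequence is an axiom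
(clause of `F`) or a resolvent of two earlier clauses, and the last clause is empty. -/
def IsRefutation (F : CNF) (L : List Clause) : Prop :=
  L ≠ [] ∧ L.getLast? = some (∅ : Clause) ∧
    ∀ i < L.length, L.getD i ∅ ∈ F ∨
      ∃ j k, j < i ∧ k < i ∧ Resolvent (L.getD j ∅) (L.getD k ∅) (L.getD i ∅)

/-- Resolution hardness: the minimum length of a resolution refutation. -/
noncomputable def hardness (F : CNF) : ℕ :=
  sInf {n | ∃ L : List Clause, IsRefutation F L ∧ L.length = n}

/-- The restriction `F[¬C]`: the result of setting all literals of `C` to 0 in `F`. -/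
def restrictByNegC (F : CNF) (C : Clause) : CNF :=
  (F.filter fun D => ∀ ℓ ∈ C, Lit.neg ℓ ∉ D).image fun D => D \ C

/-- `C` is a clause interpolant of `(F, H)`: `F ⊨ C` and `{C} ∪ H` is unsatisfiable. -/
def ClauseInterpolant (C : Clause) (F H : CNF) : Prop :=
  C.NonTaut ∧ Entails F {C} ∧ Unsat (insert C H)

/-- `F` is a factor of `G`: a subset of `G` logically equivalent to a single clause. -/
def IsFactor (F G : CNF) : Prop :=
  F ⊆ G ∧ ∃ C : Clause, C.NonTaut ∧ Equivalent F {C}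

/-- `F` is a pseudo-factor of `G`: `(F, G \ F)` has a clause interpolant. -/
def IsPseudoFactor (F G : CNF) : Prop :=
  F ⊆ G ∧ ∃ C : Clause, ClauseInterpolant C F (G \ F)

/-- `G` is irreducible: every factor has size 1 or `|G|`. -/
def CNF.Irreducible (G : CNF) : Prop :=
  ∀ F : CNF, IsFactor F G → F.card = 1 ∨ F.card = G.card

/-- `G` is strongly irreducible: every pseudo-factor has size 1 or `|G|`. -/
def StronglyIrreducible (G : CNF) : Prop :=
  ∀ F : CNF, IsPseudoFactor F G → F.card = 1 ∨ F.card = G.card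

/-- `F` is minimally unsatisfiable: unsatisfiable, but every proper subset is satisfiable. -/
def MinimallyUnsat (F : CNF) : Prop :=
  Unsat F ∧ ∀ G : CNF, G ⊂ F → ∃ τ : ℕ → Bool, SatCNF τ G

/-- A resolution derivation from `F`, most recent clause first. -/
inductive IsDerivation (F : CNF) : List Clause → Prop
  | nil : IsDerivation F []
  | ax {D : Clause} {L : List Clause} : IsDerivation F L → D ∈ F → IsDerivation F (D :: L)
  | res {A B D : Clause} {L : List Clause} : IsDerivation F L → A ∈ L → B ∈ L →
      Resolvent A B D → IsDerivation F (D :: L)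

@[simp] theorem Lit.neg_neg (ℓ : Lit) : ℓ.neg.neg = ℓ := by
  simp [Lit.neg]

theorem Lit.mem_image_neg {ℓ : Lit} {C : Clause} : ℓ ∈ C.image Lit.neg ↔ ℓ.neg ∈ C := by
  rw [Finset.mem_image]
  constructor
  · rintro ⟨x, hx, rfl⟩
    simpa using hx
  · exact fun h => ⟨_, h, ℓ.neg_neg⟩

theorem inter_image_neg_eq_singleton {A B : Clause} {ℓ : Lit} :
    A ∩ B.image Lit.neg = {ℓ} ↔
      ℓ ∈ A ∧ ℓ.neg ∈ B ∧ ∀ x ∈ A, x.neg ∈ B → x = ℓ := by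
  simp only [Finset.eq_singleton_iff_unique_mem, Finset.mem_inter, Lit.mem_image_neg, and_imp,
    and_assoc]

theorem resolvent_iff {A B D : Clause} :
    Resolvent A B D ↔ ∃ ℓ : Lit, (ℓ ∈ A ∧ ℓ.neg ∈ B ∧ ∀ x ∈ A, x.neg ∈ B → x = ℓ) ∧
      ∀ x, x ∈ D ↔ (x ∈ A ∨ x ∈ B) ∧ x ≠ ℓ ∧ x ≠ ℓ.neg := by
  simp only [Resolvent, inter_image_neg_eq_singleton]
  simp only [Finset.ext_iff, Finset.mem_sdiff, Finset.mem_union, Finset.mem_insert,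
    Finset.mem_singleton, not_or, ne_eq]

theorem exists_resolvent {A B : Clause} {ℓ : Lit} (hA : ℓ ∈ A) (hB : ℓ.neg ∈ B)
    (h : ∀ x ∈ A, x.neg ∈ B → x = ℓ) :
    ∃ D, Resolvent A B D ∧ ∀ x, x ∈ D ↔ (x ∈ A ∨ x ∈ B) ∧ x ≠ ℓ ∧ x ≠ ℓ.neg :=
  ⟨(A ∪ B) \ {ℓ, ℓ.neg}, ⟨ℓ, inter_image_neg_eq_singleton.2 ⟨hA, hB, h⟩, rfl⟩, by simp⟩

theorem Resolvent.nonTaut {A B D : Clause} (h : Resolvent A B D) (hA : A.NonTaut)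
    (hB : B.NonTaut) : D.NonTaut := by
  obtain ⟨ℓ, ⟨-, -, huniq⟩, hD⟩ := resolvent_iff.1 h
  intro x hx hx'
  rw [hD] at hx hx'
  obtain ⟨h1, h2, h3⟩ := hx
  obtain ⟨h1', -⟩ := hx'
  rcases h1 with h1 | h1 <;> rcases h1' with h1' | h1'
  · exact hA x h1 h1'
  · exact h2 (huniq x h1 h1')
  · refine h3 ?_
    rw [← huniq x.neg h1' (by simpa using h1), Lit.neg_neg]
  · exact hB x h1 h1'

namespace IsDerivation

theorem nonTaut {F : CNF} (hF : F.WellFormed) {L : List Clause} (h : IsDerivation F L) :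
    ∀ D ∈ L, D.NonTaut := by
  induction h with
  | nil => simp
  | ax _ hD ih => exact List.forall_mem_cons.2 ⟨hF _ hD, ih⟩
  | res _ hA hB hr ih => exact List.forall_mem_cons.2 ⟨hr.nonTaut (ih _ hA) (ih _ hB), ih⟩

theorem append {F : CNF} {L M : List Clause} (hL : IsDerivation F L) (hM : IsDerivation F M) :
    IsDerivation F (L ++ M) := by
  induction hL with
  | nil => exact hM
  | ax _ hD ih => exact ih.ax hD
  | res _ hA hB hr ih =>
    exact ih.res (List.mem_append_left _ hA) (List.mem_append_left _ hB) hr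

theorem exists_suffix {F : CNF} {L : List Clause} (h : IsDerivation F L) {D : Clause}
    (hD : D ∈ L) : ∃ M, IsDerivation F (D :: M) ∧ (D :: M) <:+ L := by
  induction h with
  | nil => simp at hD
  | @ax E L h hE ih =>
    rcases List.mem_cons.1 hD with rfl | hD
    · exact ⟨L, h.ax hE, List.suffix_rfl⟩
    · obtain ⟨M, hM, hs⟩ := ih hD
      exact ⟨M, hM, hs.trans (List.suffix_cons _ _)⟩
  | @res A B E L h hA hB hr ih =>
    rcases List.mem_cons.1 hD with rfl | hD
    · exact ⟨L, h.res hA hB hr, List.suffix_rfl⟩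
    · obtain ⟨M, hM, hs⟩ := ih hD
      exact ⟨M, hM, hs.trans (List.suffix_cons _ _)⟩

theorem reverse_getD {F : CNF} {L : List Clause} (h : IsDerivation F L) :
    ∀ i < L.reverse.length, L.reverse.getD i ∅ ∈ F ∨ ∃ j k, j < i ∧ k < i ∧
      Resolvent (L.reverse.getD j ∅) (L.reverse.getD k ∅) (L.reverse.getD i ∅) := by
  have step : ∀ (M : List Clause) (D : Clause),
      (∀ i < M.length, M.getD i ∅ ∈ F ∨ ∃ j k, j < i ∧ k < i ∧
        Resolvent (M.getD j ∅) (M.getD k ∅) (M.getD i ∅)) →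
      (D ∈ F ∨ ∃ A ∈ M, ∃ B ∈ M, Resolvent A B D) →
      ∀ i < (M ++ [D]).length, (M ++ [D]).getD i ∅ ∈ F ∨ ∃ j k, j < i ∧ k < i ∧
        Resolvent ((M ++ [D]).getD j ∅) ((M ++ [D]).getD k ∅) ((M ++ [D]).getD i ∅) := by
    intro M D hM hD i hi
    have old : ∀ j < M.length, (M ++ [D]).getD j ∅ = M.getD j ∅ :=
      fun j hj => List.getD_append _ _ _ _ hj
    rcases lt_or_ge i M.length with hlt | hge
    · rw [old i hlt]
      refine (hM i hlt).imp_right ?_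
      rintro ⟨j, k, hj, hk, hr⟩
      exact ⟨j, k, hj, hk, by rwa [old j (by omega), old k (by omega)]⟩
    · obtain rfl : i = M.length := by simp at hi; omega
      have new : (M ++ [D]).getD M.length ∅ = D := by simp
      rw [new]
      refine hD.imp_right ?_
      rintro ⟨A, hA, B, hB, hr⟩
      obtain ⟨j, hj, rfl⟩ := List.mem_iff_getElem.1 hA
      obtain ⟨k, hk, rfl⟩ := List.mem_iff_getElem.1 hB
      refine ⟨j, k, hj, hk, ?_⟩
      rwa [old j hj, old k hk, List.getD_eq_getElem _ _ hj, List.getD_eq_getElem _ _ hk]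
  induction h with
  | nil => simp
  | ax _ hD ih =>
    rw [List.reverse_cons]
    exact step _ _ ih (.inl hD)
  | res _ hA hB hr ih =>
    rw [List.reverse_cons]
    exact step _ _ ih (.inr ⟨_, List.mem_reverse.2 hA, _, List.mem_reverse.2 hB, hr⟩)

theorem exists_isRefutation {F : CNF} {L : List Clause} (h : IsDerivation F L)
    (he : ∅ ∈ L) : ∃ R, IsRefutation F R ∧ R.length ≤ L.length := by
  obtain ⟨M, hM, hs⟩ := h.exists_suffix he
  exact ⟨(∅ :: M).reverse, ⟨by simp, by simp, hM.reverse_getD⟩, by simpa using hs.length_le⟩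

/-- A derivation from `F[¬C]` lifts to one from `F` whose clauses agree outside `C`. -/
theorem lift_restrict {F : CNF} {C : Clause} {L : List Clause}
    (h : IsDerivation (restrictByNegC F C) L) :
    ∃ M, IsDerivation F M ∧ M.length = L.length ∧
      ∀ D ∈ L, ∃ E ∈ M, E \ C = D ∧ ∀ ℓ ∈ C, ℓ.neg ∉ E := by
  induction h with
  | nil => exact ⟨[], .nil, rfl, by simp⟩
  | @ax D L _ hD ih =>
    obtain ⟨M, hM, hlen, hall⟩ := ih
    simp only [restrictByNegC, Finset.mem_image, Finset.mem_filter] at hD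
    obtain ⟨E, ⟨hE, hneg⟩, rfl⟩ := hD
    refine ⟨E :: M, hM.ax hE, by simp [hlen], List.forall_mem_cons.2 ⟨?_, fun D hD => ?_⟩⟩
    · exact ⟨E, by simp, rfl, hneg⟩
    · obtain ⟨E', hE', h'⟩ := hall D hD
      exact ⟨E', List.mem_cons_of_mem _ hE', h'⟩
  | @res A B D L _ hA hB hr ih =>
    obtain ⟨M, hM, hlen, hall⟩ := ih
    obtain ⟨A, hAM, rfl, hAC⟩ := hall A hA
    obtain ⟨B, hBM, rfl, hBC⟩ := hall B hB
    obtain ⟨ℓ, ⟨hℓA, hℓB, huniq⟩, hD⟩ := resolvent_iff.1 hr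
    simp only [Finset.mem_sdiff] at hℓA hℓB huniq hD
    obtain ⟨E, hE, hmem⟩ := exists_resolvent hℓA.1 hℓB.1 fun x hxA hxB =>
      huniq x ⟨hxA, fun hxC => hBC x hxC hxB⟩
        ⟨hxB, fun hxC => hAC _ hxC (by simpa using hxA)⟩
    refine ⟨E :: M, hM.res hAM hBM hE, by simp [hlen],
      List.forall_mem_cons.2 ⟨⟨E, by simp, ?_, ?_⟩, fun D hD => ?_⟩⟩
    · ext x
      simp only [Finset.mem_sdiff, hmem, hD]
      tauto
    · intro x hx hxE
      rcases ((hmem _).1 hxE).1 with h | h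
      · exact hAC x hx h
      · exact hBC x hx h
    · obtain ⟨E', hE', h'⟩ := hall D hD
      exact ⟨E', List.mem_cons_of_mem _ hE', h'⟩

/-- An axiom `C` of a derivation may be replaced by an already derived subclause. -/
theorem subsume {G H : CNF} {C E : Clause} {M L : List Clause} (hHG : H ⊆ G)
    (hwf : (insert C H : CNF).WellFormed) (hM : IsDerivation G M) (hE : E ∈ M) (hEC : E ⊆ C)
    (h : IsDerivation (insert C H) L) :
    ∃ N, IsDerivation G N ∧ N.length ≤ M.length + (L.filter (· ≠ C)).length ∧ E ∈ N ∧
      ∀ D ∈ L, ∃ D' ∈ N, D' ⊆ D := by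
  suffices key : ∀ (L : List Clause) (D : Clause),
      (∃ N, IsDerivation G N ∧ N.length ≤ M.length + (L.filter (· ≠ C)).length ∧ E ∈ N ∧
        ∀ D ∈ L, ∃ D' ∈ N, D' ⊆ D) →
      (∀ N, IsDerivation G N → (∀ D ∈ L, ∃ D' ∈ N, D' ⊆ D) → D ≠ C →
        ∃ D' ⊆ D, D' ∈ N ∨ IsDerivation G (D' :: N)) →
      ∃ N, IsDerivation G N ∧ N.length ≤ M.length + ((D :: L).filter (· ≠ C)).length ∧ E ∈ N ∧
        ∀ K ∈ D :: L, ∃ K' ∈ N, K' ⊆ K by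
    induction h with
    | nil => exact ⟨M, hM, by simp, hE, by simp⟩
    | @ax D L _ hD ih =>
      refine key L D ih fun N hN _ hDC => ⟨D, subset_rfl, .inr (hN.ax (hHG ?_))⟩
      exact (Finset.mem_insert.1 hD).resolve_left hDC
    | @res A B D L hL hA hB hr ih =>
      refine key L D ih fun N hN hall _ => ?_
      obtain ⟨A', hA', hAA⟩ := hall A hA
      obtain ⟨B', hB', hBB⟩ := hall B hB
      have hAt := hL.nonTaut hwf A hA
      have hBt := hL.nonTaut hwf B hB
      obtain ⟨ℓ, ⟨hℓA, hℓB, huniq⟩, hD⟩ := resolvent_iff.1 hr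
      by_cases hℓA' : ℓ ∈ A'
      · by_cases hℓB' : ℓ.neg ∈ B'
        · obtain ⟨D', hD', hmem⟩ := exists_resolvent hℓA' hℓB'
            fun x hx hx' => huniq x (hAA hx) (hBB hx')
          refine ⟨D', fun x hx => ?_, .inr (hN.res hA' hB' hD')⟩
          obtain ⟨hx, hne⟩ := (hmem x).1 hx
          exact (hD x).2 ⟨hx.imp (@hAA x) (@hBB x), hne⟩
        · refine ⟨B', fun x hx => (hD x).2 ⟨.inr (hBB hx), ?_, ?_⟩, .inl hB'⟩
          · rintro rfl
            exact hBt _ (hBB hx) hℓB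
          · rintro rfl
            exact hℓB' hx
      · refine ⟨A', fun x hx => (hD x).2 ⟨.inl (hAA hx), ?_, ?_⟩, .inl hA'⟩
        · rintro rfl
          exact hℓA' hx
        · rintro rfl
          exact hAt _ hℓA (hAA hx)
  rintro L D ⟨N, hN, hlen, hEN, hall⟩ hstep
  by_cases hDC : D = C
  · subst hDC
    exact ⟨N, hN, by simpa using hlen, hEN, List.forall_mem_cons.2 ⟨⟨E, hEN, hEC⟩, hall⟩⟩
  · have hlen' : ((D :: L).filter (· ≠ C)).length = (L.filter (· ≠ C)).length + 1 := by
      simp [hDC]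
    obtain ⟨D', hD', hN' | hN'⟩ := hstep N hN hall hDC
    · exact ⟨N, hN, by omega, hEN, List.forall_mem_cons.2 ⟨⟨D', hN', hD'⟩, hall⟩⟩
    · refine ⟨D' :: N, hN', by rw [List.length_cons]; omega, List.mem_cons_of_mem _ hEN,
        List.forall_mem_cons.2 ⟨⟨D', by simp, hD'⟩, fun D hD => ?_⟩⟩
      obtain ⟨D'', h, h'⟩ := hall D hD
      exact ⟨D'', List.mem_cons_of_mem _ h, h'⟩

theorem mono_of_forall_mem {F G : CNF} {L : List Clause} (h : IsDerivation F L)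
    (hG : ∀ D ∈ L, D ∈ F → D ∈ G) : IsDerivation G L := by
  induction h with
  | nil => exact .nil
  | ax _ hD ih =>
    rw [List.forall_mem_cons] at hG
    exact (ih hG.2).ax (hG.1 hD)
  | res _ hA hB hr ih =>
    rw [List.forall_mem_cons] at hG
    exact (ih hG.2).res hA hB hr

end IsDerivation

theorem IsRefutation.isDerivation_reverse {F : CNF} {L : List Clause} (h : IsRefutation F L) :
    IsDerivation F L.reverse := by
  suffices key : ∀ n ≤ L.length, IsDerivation F (L.take n).reverse by
    simpa using key L.length le_rfl
  intro n
  induction n with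
  | zero => exact fun _ => by simpa using IsDerivation.nil
  | succ n ih =>
    intro hn
    have hD := ih (by omega)
    rw [List.take_succ_eq_append_getElem (by omega), List.reverse_append,
      List.reverse_singleton, List.singleton_append]
    have mem : ∀ j < n, L.getD j ∅ ∈ (L.take n).reverse := by
      intro j hj
      rw [List.mem_reverse, List.getD_eq_getElem _ _ (by omega), List.mem_take_iff_getElem]
      exact ⟨j, by omega, rfl⟩
    have hstep := h.2.2 n (by omega)
    rw [List.getD_eq_getElem _ _ (show n < L.length by omega)] at hstep
    obtain hF | ⟨j, k, hj, hk, hr⟩ := hstep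
    · exact hD.ax hF
    · exact hD.res (mem j hj) (mem k hk) hr

theorem IsRefutation.empty_mem {F : CNF} {L : List Clause} (h : IsRefutation F L) : ∅ ∈ L :=
  List.mem_of_getLast? h.2.1

/-- Refutational completeness of resolution. -/
theorem Unsat.exists_isDerivation {F : CNF} (hF : Unsat F) : ∃ L, IsDerivation F L ∧ ∅ ∈ L := by
  obtain ⟨n, hn⟩ : ∃ n, ∀ D ∈ F, ∀ ℓ ∈ D, ℓ.1 < n := by
    refine ⟨(cnfVars F).sup id + 1, fun D hD ℓ hℓ => Nat.lt_succ_of_le ?_⟩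
    refine Finset.le_sup (f := id) (Finset.mem_sup.2 ⟨D, hD, Finset.mem_image_of_mem _ hℓ⟩)
  have tree : ∀ k ≤ n, ∀ τ : ℕ → Bool, ∃ L, IsDerivation F L ∧
      ∃ D ∈ L, ∀ ℓ ∈ D, ℓ.1 < k ∧ τ ℓ.1 ≠ ℓ.2 := by
    intro k hk
    induction hk using Nat.decreasingInduction with
    | self =>
      intro τ
      obtain ⟨D, hD, hτ⟩ : ∃ D ∈ F, ¬ SatClause τ D := by
        by_contra! h
        exact hF ⟨τ, h⟩
      exact ⟨[D], IsDerivation.nil.ax hD, D, by simp,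
        fun ℓ hℓ => ⟨hn D hD ℓ hℓ, fun h => hτ ⟨ℓ, hℓ, h⟩⟩⟩
    | of_succ k hk ih =>
      intro τ
      obtain ⟨L₁, hL₁, A, hA, hAf⟩ := ih (Function.update τ k false)
      obtain ⟨L₂, hL₂, B, hB, hBf⟩ := ih (Function.update τ k true)
      have old : ∀ (b : Bool) (ℓ : Lit), ℓ.1 < k + 1 ∧ Function.update τ k b ℓ.1 ≠ ℓ.2 →
          ℓ ≠ (k, !b) → ℓ.1 < k ∧ τ ℓ.1 ≠ ℓ.2 := by
        rintro b ⟨v, c⟩ ⟨hv, hne⟩ hℓ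
        rcases eq_or_ne v k with rfl | hvk
        · cases b <;> cases c <;> simp_all
        · simp only [Function.update_of_ne hvk] at hne
          exact ⟨by dsimp only at hv ⊢; omega, hne⟩
      by_cases hkA : (k, true) ∈ A
      · by_cases hkB : (k, false) ∈ B
        · obtain ⟨D, hD, hmem⟩ := exists_resolvent (ℓ := (k, true)) hkA hkB (by
            intro x hx hx'
            by_contra hne
            have h1 := old false x (hAf x hx) hne
            have h2 := old true x.neg (hBf _ hx') (by
              intro h
              apply hne
              rw [← x.neg_neg, h]
              rfl)
            revert h1 h2
            simp only [Lit.neg]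
            cases τ x.1 <;> cases x.2 <;> simp)
          refine ⟨D :: (L₁ ++ L₂), (hL₁.append hL₂).res (List.mem_append_left _ hA)
            (List.mem_append_right _ hB) hD, D, by simp, fun ℓ hℓ => ?_⟩
          obtain ⟨h | h, hne, hne'⟩ := (hmem ℓ).1 hℓ
          · exact old false ℓ (hAf ℓ h) hne
          · exact old true ℓ (hBf ℓ h) hne'
        · exact ⟨L₂, hL₂, B, hB, fun ℓ hℓ => old true ℓ (hBf ℓ hℓ) (by rintro rfl; exact hkB hℓ)⟩
      · exact ⟨L₁, hL₁, A, hA, fun ℓ hℓ => old false ℓ (hAf ℓ hℓ) (by rintro rfl; exact hkA hℓ)⟩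
  obtain ⟨L, hL, D, hD, h⟩ := tree 0 n.zero_le fun _ => false
  obtain rfl : D = ∅ := Finset.eq_empty_of_forall_notMem fun ℓ hℓ => by simpa using (h ℓ hℓ).1
  exact ⟨L, hL, hD⟩

theorem Unsat.exists_isDerivation_length_eq_hardness {F : CNF} (hF : Unsat F) :
    ∃ L, IsDerivation F L ∧ ∅ ∈ L ∧ L.length = hardness F := by
  obtain ⟨L, hL, he⟩ := hF.exists_isDerivation
  obtain ⟨R, hR, -⟩ := hL.exists_isRefutation he
  obtain ⟨R', hR', hlen⟩ :=
    Nat.sInf_mem (s := {n | ∃ L, IsRefutation F L ∧ L.length = n}) ⟨_, R, hR, rfl⟩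
  exact ⟨R'.reverse, hR'.isDerivation_reverse, by simpa using hR'.empty_mem, by rw [List.length_reverse, hlen, hardness]⟩

theorem unsat_restrictByNegC {F : CNF} {C : Clause} (hC : C.NonTaut) (h : Entails F {C}) :
    Unsat (restrictByNegC F C) := by
  rintro ⟨τ, hτ⟩
  let σ : ℕ → Bool := fun v => if (v, true) ∈ C then false else if (v, false) ∈ C then true else τ v
  have hσC : ∀ ℓ ∈ C, σ ℓ.1 = !ℓ.2 := by
    rintro ⟨v, b⟩ hℓ
    have := hC _ hℓ
    cases b <;> simp_all [σ, Lit.neg]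
  have hσF : SatCNF σ F := by
    intro D hD
    by_cases hneg : ∀ ℓ ∈ C, ℓ.neg ∉ D
    · obtain ⟨⟨v, b⟩, hℓ, hsat⟩ := hτ (D \ C) (Finset.mem_image_of_mem _ (Finset.mem_filter.2 ⟨hD, hneg⟩))
      obtain ⟨hℓD, hℓC⟩ := Finset.mem_sdiff.1 hℓ
      have hℓC' : Lit.neg (v, b) ∉ C := fun h => hneg _ h (by simpa using hℓD)
      refine ⟨(v, b), hℓD, ?_⟩
      cases b <;> simp_all [σ, Lit.neg, SatLit]
    · push Not at hneg
      obtain ⟨ℓ, hℓ, hD'⟩ := hneg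
      exact ⟨ℓ.neg, hD', hσC ℓ hℓ⟩
  obtain ⟨ℓ, hℓ, hs⟩ := h σ hσF C (by simp)
  have := hσC ℓ hℓ
  rw [SatLit, this] at hs
  simp at hs

/-- if `G` is unsatisfiable, `F ⊆ G` is a pseudo-factor of `G`, and `C`
is a clause interpolant of `(F, G \ F)`, then `G` has a resolution refutation of
length at most `h(F[¬C]) + h({C} ∪ (G \ F)) − 1`. -/
theorem hardness_bound_pseudo_factor (G F : CNF) (C : Clause)
    (hwf : G.WellFormed) (hunsat : Unsat G) (hFG : F ⊆ G)
    (hint : ClauseInterpolant C F (G \ F)) :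
    ∃ L : List Clause, IsRefutation G L ∧
      L.length ≤ hardness (restrictByNegC F C) + hardness (insert C (G \ F)) - 1 := by
  obtain ⟨hC, hent, hun⟩ := hint
  obtain ⟨L₁, hL₁, he₁, hlen₁⟩ :=
    (unsat_restrictByNegC hC hent).exists_isDerivation_length_eq_hardness
  obtain ⟨L₂, hL₂, he₂, hlen₂⟩ := hun.exists_isDerivation_length_eq_hardness
  rw [← hlen₁, ← hlen₂]
  have hpos := List.length_pos_of_mem he₁
  by_cases hCL : C ∈ L₂
  · obtain ⟨M, hM, hMlen, hall⟩ := hL₁.lift_restrict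
    obtain ⟨E, hE, hEC, -⟩ := hall ∅ he₁
    have hwf' : (insert C (G \ F) : CNF).WellFormed := by
      intro D hD
      rcases Finset.mem_insert.1 hD with rfl | hD
      · exact hC
      · exact hwf D (Finset.sdiff_subset hD)
    obtain ⟨N, hN, hNlen, -, hNall⟩ := IsDerivation.subsume Finset.sdiff_subset hwf'
      (hM.mono_of_forall_mem fun D _ hD => hFG hD) hE (Finset.sdiff_eq_empty_iff_subset.1 hEC) hL₂
    obtain ⟨D, hD, hDe⟩ := hNall ∅ he₂
    obtain rfl := Finset.subset_empty.1 hDe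
    obtain ⟨R, hR, hRlen⟩ := hN.exists_isRefutation hD
    have hlt : (L₂.filter (· ≠ C)).length < L₂.length :=
      List.length_filter_lt_length_iff_exists.2 ⟨C, hCL, by simp⟩
    exact ⟨R, hR, by omega⟩
  · have hL₂' : IsDerivation G L₂ := hL₂.mono_of_forall_mem fun D hD hDF =>
      Finset.sdiff_subset ((Finset.mem_insert.1 hDF).resolve_left (by rintro rfl; exact hCL hD))
    obtain ⟨R, hR, hRlen⟩ := hL₂'.exists_isRefutation he₂
    exact ⟨R, hR, by omega⟩
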